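/- arXiv:1907.01031 — 11 statements merged into one kernel-verified Lean document; each statement's English description precedes it below -/
import Mathlib

section
/- Suppose 𝒩 is nonempty, 0 ≤ q1 i ≤ qg i ≤ 1 for every i ∈ 𝒩, cs ≥ 0, and for every component i ∈ 𝒩 the single-component optimality condition cpm i + cs + q1 i·(ccm i + cs) < qg i·(ccm i + cs) holds (i.e., without economic dependence it is optimal to maintain every component). Then maintaining all components is strictly optimal: for every partition (N0,N1) of 𝒩 with N0 nonempty, C(∅,𝒩) < C(N0,N1). -/
open Finset

variable {α : Type*}

/-- Two-stage expected total cost of a partition `(N0, N1)`: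
`C(N0,N1) = Σ_{i∈N1} cpm i + cs·[N1 ≠ ∅] + Σ_{i∈N0} qg i·ccm i + Σ_{i∈N1} q1 i·ccm i
  + cs·(1 − Π_{i∈N0}(1 − qg i)·Π_{i∈N1}(1 − q1 i))`. -/
noncomputable def cost (q1 qg cpm ccm : α → ℝ) (cs : ℝ) (N0 N1 : Finset α) : ℝ :=
  (∑ i ∈ N1, cpm i) + (if N1.Nonempty then cs else 0)
    + (∑ i ∈ N0, qg i * ccm i) + (∑ i ∈ N1, q1 i * ccm i)
    + cs * (1 - (∏ i ∈ N0, (1 - qg i)) * ∏ i ∈ N1, (1 - q1 i))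

/-- `ρ_k = (cpm k − (qg k − q1 k)·ccm k)/cs`. -/
noncomputable def rho (q1 qg cpm ccm : α → ℝ) (cs : ℝ) (k : α) : ℝ :=
  (cpm k - (qg k - q1 k) * ccm k) / cs

/-- `r_N = Π_{i∈N}(1 − q1 i)/(1 − qg i) − 1`. -/
noncomputable def rSet (q1 qg : α → ℝ) (N : Finset α) : ℝ :=
  (∏ i ∈ N, (1 - q1 i) / (1 - qg i)) - 1

/-- `s_N = 1 − Π_{i∈N}(1 − qg i)/(1 − q1 i)`. -/
noncomputable def sSet (q1 qg : α → ℝ) (N : Finset α) : ℝ :=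
  1 - ∏ i ∈ N, (1 - qg i) / (1 - q1 i)

/-- `p(N0,N1) = Π_{i∈N0}(1 − qg i)·Π_{i∈N1}(1 − q1 i)`. -/
noncomputable def pProb (q1 qg : α → ℝ) (N0 N1 : Finset α) : ℝ :=
  (∏ i ∈ N0, (1 - qg i)) * ∏ i ∈ N1, (1 - q1 i)

/-- `Δ_r(N0,N1,N)` for `N ⊆ N0`. -/
noncomputable def deltaR (q1 qg cpm ccm : α → ℝ) (cs : ℝ) (N0 N1 N : Finset α) : ℝ :=
  if N1.Nonempty then
    (∑ k ∈ N, rho q1 qg cpm ccm cs k) / (rSet q1 qg N * pProb q1 qg N0 N1)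
  else
    (1 + ∑ k ∈ N, rho q1 qg cpm ccm cs k) / (rSet q1 qg N * pProb q1 qg N0 N1)

/-- `Δ_s(N0,N1,N)` for `N ⊆ N1`. -/
noncomputable def deltaS [DecidableEq α] (q1 qg cpm ccm : α → ℝ) (cs : ℝ)
    (N0 N1 N : Finset α) : ℝ :=
  if (N1 \ N).Nonempty then
    (∑ k ∈ N, rho q1 qg cpm ccm cs k) / (sSet q1 qg N * pProb q1 qg N0 N1)
  else
    (1 + ∑ k ∈ N, rho q1 qg cpm ccm cs k) / (sSet q1 qg N * pProb q1 qg N0 N1)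

/-- For nonempty `s` and `a i, b i ∈ [0, 1]`, the product of `a` exceeds the product of `b`
by at least `1 - ∑ i ∈ s, (1 - (a i - b i))`. -/
lemma one_add_prod_sub_prod_le_sum {s : Finset α} (hs : s.Nonempty) (a b : α → ℝ)
    (ha : ∀ i ∈ s, 0 ≤ a i ∧ a i ≤ 1) (hb : ∀ i ∈ s, 0 ≤ b i ∧ b i ≤ 1) :
    1 + ∏ i ∈ s, b i - ∏ i ∈ s, a i ≤ ∑ i ∈ s, (1 - (a i - b i)) := by
  induction hs using Finset.Nonempty.cons_induction with
  | singleton i => simp only [prod_singleton, sum_singleton]; linarith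
  | cons i s hi hs ih =>
    simp only [mem_cons, forall_eq_or_imp] at ha hb
    have hA := prod_le_one (fun j hj => (ha.2 j hj).1) (fun j hj => (ha.2 j hj).2)
    have hB := prod_le_one (fun j hj => (hb.2 j hj).1) (fun j hj => (hb.2 j hj).2)
    have hB0 := prod_nonneg (fun j hj => (hb.2 j hj).1)
    have ih := ih ha.2 hb.2
    rw [prod_cons, prod_cons, sum_cons]
    have haA := mul_nonneg (sub_nonneg.2 ha.1.2) (sub_nonneg.2 hA)
    have hbB := mul_nonneg hb.1.1 (sub_nonneg.2 hB)
    linarith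

theorem maintain_all_optimal [DecidableEq α]
    (Ncal : Finset α) (q1 qg cpm ccm : α → ℝ) (cs : ℝ)
    (hNcal : Ncal.Nonempty)
    (hq : ∀ i ∈ Ncal, 0 ≤ q1 i ∧ q1 i ≤ qg i ∧ qg i ≤ 1)
    (hcs : 0 ≤ cs)
    (hopt : ∀ i ∈ Ncal, cpm i + cs + q1 i * (ccm i + cs) < qg i * (ccm i + cs)) :
    ∀ N0 N1 : Finset α, Disjoint N0 N1 → N0 ∪ N1 = Ncal → N0.Nonempty →
      cost q1 qg cpm ccm cs (∅ : Finset α) Ncal < cost q1 qg cpm ccm cs N0 N1 := by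
  rintro N0 N1 hdisj rfl hN0
  have hq0 : ∀ i ∈ N0, 0 ≤ q1 i ∧ q1 i ≤ qg i ∧ qg i ≤ 1 :=
    fun i hi => hq i (mem_union_left _ hi)
  have hq1 : ∀ i ∈ N1, 0 ≤ q1 i ∧ q1 i ≤ qg i ∧ qg i ≤ 1 :=
    fun i hi => hq i (mem_union_right _ hi)
  have hsum : ∑ i ∈ N0, (cpm i + q1 i * ccm i + cs * (1 - ((1 - q1 i) - (1 - qg i))))
      < ∑ i ∈ N0, qg i * ccm i :=
    sum_lt_sum_of_nonempty hN0 fun i hi => by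
      linarith [hopt i (mem_union_left _ hi)]
  rw [sum_add_distrib, sum_add_distrib, ← mul_sum] at hsum
  simp only [cost, sum_union hdisj, prod_union hdisj, if_pos hNcal, sum_empty, prod_empty]
  rcases N1.eq_empty_or_nonempty with rfl | hN1
  · have hprod := mul_le_mul_of_nonneg_left
      (one_add_prod_sub_prod_le_sum hN0 (fun i => 1 - q1 i) (fun i => 1 - qg i)
        (fun i hi => by constructor <;> grind)
        (fun i hi => by constructor <;> grind)) hcs
    simp only [sum_empty, prod_empty, Finset.not_nonempty_empty, if_false]
    linarith
  · have hrest : 0 ≤ cs * ∑ i ∈ N0, (1 - ((1 - q1 i) - (1 - qg i))) :=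
      mul_nonneg hcs (sum_nonneg fun i hi => by grind)
    have hmono : ∏ i ∈ N0, (1 - qg i) ≤ ∏ i ∈ N0, (1 - q1 i) :=
      prod_le_prod (fun i hi => by grind) (fun i hi => by grind)
    have hnn : 0 ≤ ∏ i ∈ N1, (1 - q1 i) :=
      prod_nonneg fun i hi => by grind
    have hprod := mul_le_mul_of_nonneg_left (mul_le_mul_of_nonneg_right hmono hnn) hcs
    rw [if_pos hN1]
    linarith
end

section
/- Let (N0,N1) be a partition of 𝒩 and let N be a nonempty subset of N0. Assume 0 ≤ q1 i ≤ qg i < 1 for every i ∈ 𝒩, q1 i < qg i for every i ∈ N, and cs > 0. Then C(N0\N, N1∪N) < C(N0,N1) (i.e., additionally maintaining the components of N strictly reduces the total cost) if and only if Δ_r(N0,N1,N) < 1. -/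
open Finset

variable {α : Type*}

theorem rSet_pos {q1 qg : α → ℝ} {N : Finset α} (hN : N.Nonempty)
    (h : ∀ i ∈ N, q1 i < qg i) (hg : ∀ i ∈ N, qg i < 1) : 0 < rSet q1 qg N := by
  have key : ∏ _i ∈ N, (1 : ℝ) < ∏ i ∈ N, (1 - q1 i) / (1 - qg i) := by
    refine Finset.prod_lt_prod_of_nonempty (fun _ _ => one_pos) (fun i hi => ?_) hN
    rw [one_lt_div (sub_pos.2 (hg i hi))]
    linarith [h i hi]
  rw [Finset.prod_const_one] at key
  exact sub_pos.2 key

theorem pProb_pos {q1 qg : α → ℝ} {N0 N1 : Finset α} (h0 : ∀ i ∈ N0, qg i < 1)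
    (h1 : ∀ i ∈ N1, q1 i < 1) : 0 < pProb q1 qg N0 N1 :=
  mul_pos (Finset.prod_pos fun i hi => sub_pos.2 (h0 i hi))
    (Finset.prod_pos fun i hi => sub_pos.2 (h1 i hi))

theorem pProb_sdiff_union [DecidableEq α] {q1 qg : α → ℝ} {N0 N1 N : Finset α}
    (hdisj : Disjoint N1 N) (hN : N ⊆ N0) (hg : ∀ i ∈ N, qg i ≠ 1) :
    pProb q1 qg (N0 \ N) (N1 ∪ N) = (1 + rSet q1 qg N) * pProb q1 qg N0 N1 := by
  have hne : ∏ i ∈ N, (1 - qg i) ≠ 0 :=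
    Finset.prod_ne_zero_iff.2 fun i hi => sub_ne_zero.2 (hg i hi).symm
  unfold pProb rSet
  rw [← Finset.prod_sdiff hN, Finset.prod_union hdisj, Finset.prod_div_distrib]
  field_simp
  ring

theorem cost_sdiff_union_sub_cost [DecidableEq α] {q1 qg : α → ℝ} (cpm ccm : α → ℝ) {cs : ℝ}
    {N0 N1 N : Finset α} (hdisj : Disjoint N1 N) (hN : N ⊆ N0) (hNne : N.Nonempty)
    (hg : ∀ i ∈ N, qg i ≠ 1) (hcs : cs ≠ 0) :
    cost q1 qg cpm ccm cs (N0 \ N) (N1 ∪ N) - cost q1 qg cpm ccm cs N0 N1 =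
      cs * ((if N1.Nonempty then 0 else 1) + ∑ k ∈ N, rho q1 qg cpm ccm cs k
        - rSet q1 qg N * pProb q1 qg N0 N1) := by
  have hp := pProb_sdiff_union (q1 := q1) hdisj hN hg
  have hrho : cs * ∑ k ∈ N, rho q1 qg cpm ccm cs k =
      ∑ k ∈ N, cpm k - (∑ k ∈ N, qg k * ccm k - ∑ k ∈ N, q1 k * ccm k) := by
    rw [Finset.mul_sum, ← Finset.sum_sub_distrib, ← Finset.sum_sub_distrib]
    refine Finset.sum_congr rfl fun k _ => ?_
    rw [rho, mul_div_cancel₀ _ hcs, sub_mul]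
  have hsum := Finset.sum_sdiff hN (f := fun i => qg i * ccm i)
  have hif : (if N1.Nonempty then cs else 0) + cs * (if N1.Nonempty then 0 else 1) = cs := by
    split_ifs <;> simp
  unfold cost
  change _ + cs * (1 - pProb q1 qg (N0 \ N) (N1 ∪ N)) - (_ + cs * (1 - pProb q1 qg N0 N1)) = _
  rw [hp, Finset.sum_union hdisj, Finset.sum_union hdisj, if_pos (hNne.mono subset_union_right)]
  linear_combination -hrho + hsum - hif

theorem prop2_iff [DecidableEq α]
    (q1 qg cpm ccm : α → ℝ) (cs : ℝ) (N0 N1 N : Finset α)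
    (hdisj : Disjoint N0 N1) (hN : N ⊆ N0) (hNne : N.Nonempty)
    (hq : ∀ i ∈ N0 ∪ N1, 0 ≤ q1 i ∧ q1 i ≤ qg i ∧ qg i < 1)
    (hstrict : ∀ i ∈ N, q1 i < qg i)
    (hcs : 0 < cs) :
    cost q1 qg cpm ccm cs (N0 \ N) (N1 ∪ N) < cost q1 qg cpm ccm cs N0 N1 ↔
      deltaR q1 qg cpm ccm cs N0 N1 N < 1 := by
  have h0 : ∀ i ∈ N0, qg i < 1 := fun i hi => (hq i (mem_union_left _ hi)).2.2
  have h1 : ∀ i ∈ N1, q1 i < 1 := fun i hi =>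
    (hq i (mem_union_right _ hi)).2.1.trans_lt (hq i (mem_union_right _ hi)).2.2
  have hg : ∀ i ∈ N, qg i < 1 := fun i hi => h0 i (hN hi)
  have hpos : 0 < rSet q1 qg N * pProb q1 qg N0 N1 :=
    mul_pos (rSet_pos hNne hstrict hg) (pProb_pos h0 h1)
  have hdelta : deltaR q1 qg cpm ccm cs N0 N1 N =
      ((if N1.Nonempty then 0 else 1) + ∑ k ∈ N, rho q1 qg cpm ccm cs k) /
        (rSet q1 qg N * pProb q1 qg N0 N1) := by
    unfold deltaR
    split_ifs <;> simp
  rw [← sub_neg, cost_sdiff_union_sub_cost cpm ccm (hdisj.symm.mono_right hN) hN hNne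
    (fun i hi => (hg i hi).ne) hcs.ne', hdelta, div_lt_one hpos, ← smul_eq_mul,
    smul_neg_iff_of_pos_left hcs, sub_neg]
end

section
/- Let (N0,N1) be a partition of 𝒩 with N1 nonempty and let N be a nonempty subset of N0. Assume qg i < 1 for all i ∈ N and cs ≠ 0. Then C(N0\N, N1∪N) − C(N0,N1) = cs·(Σ_{k∈N} ρ_k − p(N0,N1)·r_N). -/
open Finset

variable {α : Type*}

theorem prop2_cost_difference [DecidableEq α]
    (q1 qg cpm ccm : α → ℝ) (cs : ℝ) (N0 N1 N : Finset α)
    (hdisj : Disjoint N0 N1) (hN1 : N1.Nonempty)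
    (hN : N ⊆ N0) (hNne : N.Nonempty)
    (hqg : ∀ i ∈ N, qg i < 1) (hcs : cs ≠ 0) :
    cost q1 qg cpm ccm cs (N0 \ N) (N1 ∪ N) - cost q1 qg cpm ccm cs N0 N1 =
      cs * ((∑ k ∈ N, rho q1 qg cpm ccm cs k) -
        pProb q1 qg N0 N1 * rSet q1 qg N) := by
  have hp : ∀ i ∈ N, 1 - qg i ≠ 0 := fun i hi => (sub_pos.2 (hqg i hi)).ne'
  have hd : Disjoint N1 N := (hdisj.mono_left hN).symm
  have hP : ∏ i ∈ N, (1 - qg i) ≠ 0 := prod_ne_zero_iff.2 hp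
  have hrho : cs * ∑ k ∈ N, rho q1 qg cpm ccm cs k =
      ∑ k ∈ N, cpm k - (∑ k ∈ N, qg k * ccm k - ∑ k ∈ N, q1 k * ccm k) := by
    rw [mul_sum, ← sum_sub_distrib, ← sum_sub_distrib]
    refine sum_congr rfl fun k _ => ?_
    rw [rho, mul_div_cancel₀ _ hcs, sub_mul]
  rw [mul_sub, hrho]
  simp only [cost, pProb, rSet, if_pos hN1, if_pos (hN1.mono subset_union_left),
    sum_union hd, prod_union hd, prod_div_distrib]
  rw [← sum_sdiff hN (f := fun i => qg i * ccm i), ← prod_sdiff hN (f := fun i => 1 - qg i)]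
  field_simp
  ring
end

section
/- Let N be a nonempty subset of 𝒩. Assume qg i < 1 for all i ∈ N and cs ≠ 0. Then, comparing the do-nothing partition (𝒩,∅) with the partition (𝒩\N, N), C(𝒩\N, N) − C(𝒩,∅) = cs·(1 + Σ_{k∈N} ρ_k − p(𝒩,∅)·r_N). -/
open Finset

variable {α : Type*}

theorem prop2_cost_difference_empty [DecidableEq α]
    (Ncal : Finset α) (q1 qg cpm ccm : α → ℝ) (cs : ℝ) (N : Finset α)
    (hN : N ⊆ Ncal) (hNne : N.Nonempty)
    (hqg : ∀ i ∈ N, qg i < 1) (hcs : cs ≠ 0) :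
    cost q1 qg cpm ccm cs (Ncal \ N) N - cost q1 qg cpm ccm cs Ncal (∅ : Finset α) =
      cs * (1 + (∑ k ∈ N, rho q1 qg cpm ccm cs k) -
        pProb q1 qg Ncal (∅ : Finset α) * rSet q1 qg N) := by
  have hprod : (∏ i ∈ N, (1 - qg i)) ≠ 0 :=
    Finset.prod_ne_zero_iff.mpr fun i hi => (sub_pos.mpr (hqg i hi)).ne'
  have hrho : cs * ∑ k ∈ N, rho q1 qg cpm ccm cs k =
      ∑ k ∈ N, cpm k - ∑ k ∈ N, qg k * ccm k + ∑ k ∈ N, q1 k * ccm k := by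
    rw [Finset.mul_sum, ← Finset.sum_sub_distrib, ← Finset.sum_add_distrib]
    refine Finset.sum_congr rfl fun k _ => ?_
    rw [rho, mul_div_cancel₀ _ hcs]
    ring
  have hr : (∏ i ∈ N, (1 - qg i)) * rSet q1 qg N =
      (∏ i ∈ N, (1 - q1 i)) - ∏ i ∈ N, (1 - qg i) := by
    rw [rSet, Finset.prod_div_distrib, mul_sub, mul_div_cancel₀ _ hprod, mul_one]
  simp only [cost, pProb, if_pos hNne, Finset.not_nonempty_empty, if_false,
    Finset.sum_empty, Finset.prod_empty]
  rw [← Finset.sum_sdiff hN, ← Finset.prod_sdiff hN]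
  linear_combination (cs * ∏ i ∈ Ncal \ N, (1 - qg i)) * hr - hrho
end

section
/- Let (N0,N1) be a partition of 𝒩 and let N be a nonempty subset of N1 with N1\N nonempty. Assume q1 i < 1 for all i ∈ N and cs ≠ 0. Then C(N0∪N, N1\N) − C(N0,N1) = cs·(p(N0,N1)·s_N − Σ_{k∈N} ρ_k). -/
open Finset

variable {α : Type*}

theorem prop3_cost_difference [DecidableEq α]
    (q1 qg cpm ccm : α → ℝ) (cs : ℝ) (N0 N1 N : Finset α)
    (hdisj : Disjoint N0 N1) (hN : N ⊆ N1) (hNne : N.Nonempty)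
    (hrem : (N1 \ N).Nonempty)
    (hq1 : ∀ i ∈ N, q1 i < 1) (hcs : cs ≠ 0) :
    cost q1 qg cpm ccm cs (N0 ∪ N) (N1 \ N) - cost q1 qg cpm ccm cs N0 N1 =
      cs * (pProb q1 qg N0 N1 * sSet q1 qg N -
        ∑ k ∈ N, rho q1 qg cpm ccm cs k) := by
  have hd : Disjoint N0 N := hdisj.mono_right hN
  have hpos : ∏ i ∈ N, (1 - q1 i) ≠ 0 :=
    Finset.prod_ne_zero_iff.mpr fun i hi => (sub_pos.mpr (hq1 i hi)).ne'
  have hrho : cs * ∑ k ∈ N, rho q1 qg cpm ccm cs k =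
      ∑ k ∈ N, cpm k - (∑ k ∈ N, qg k * ccm k - ∑ k ∈ N, q1 k * ccm k) := by
    rw [Finset.mul_sum, ← Finset.sum_sub_distrib, ← Finset.sum_sub_distrib]
    refine Finset.sum_congr rfl fun k _ => ?_
    rw [rho, mul_div_cancel₀ _ hcs, sub_mul]
  have hprob : (∏ i ∈ N1, (1 - q1 i)) * ∏ i ∈ N, (1 - qg i) / (1 - q1 i) =
      (∏ i ∈ N1 \ N, (1 - q1 i)) * ∏ i ∈ N, (1 - qg i) := by
    rw [Finset.prod_div_distrib, ← Finset.prod_sdiff hN, mul_assoc, mul_div_cancel₀ _ hpos]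
  unfold cost pProb sSet
  rw [if_pos hrem, if_pos (hNne.mono hN), Finset.sum_union hd, Finset.prod_union hd,
    ← Finset.sum_sdiff (f := cpm) hN, ← Finset.sum_sdiff (f := fun i => q1 i * ccm i) hN]
  linear_combination cs * (∏ i ∈ N0, (1 - qg i)) * hprob + hrho
end

section
/- Let (N0,N1) be a partition of 𝒩 with N1 nonempty. Assume q1 i < 1 for all i ∈ N1 and cs ≠ 0. Then, moving the entire maintenance set to do-nothing, C(N0∪N1, ∅) − C(N0,N1) = cs·(p(N0,N1)·s_{N1} − Σ_{k∈N1} ρ_k − 1). -/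
open Finset

variable {α : Type*}

/-- Moving all of `N1` to the do-nothing set lowers the no-failure probability by `p · s_{N1}`. -/
theorem pProb_mul_sSet (q1 qg : α → ℝ) (N0 N1 : Finset α) (hq1 : ∀ i ∈ N1, q1 i ≠ 1) :
    pProb q1 qg N0 N1 * sSet q1 qg N1 =
      pProb q1 qg N0 N1 - (∏ i ∈ N0, (1 - qg i)) * ∏ i ∈ N1, (1 - qg i) := by
  have h : ∏ i ∈ N1, (1 - q1 i) ≠ 0 :=
    prod_ne_zero_iff.mpr fun i hi => sub_ne_zero.mpr (hq1 i hi).symm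
  rw [pProb, sSet, prod_div_distrib]
  field_simp

theorem mul_sum_rho (q1 qg cpm ccm : α → ℝ) {cs : ℝ} (N : Finset α) (hcs : cs ≠ 0) :
    cs * ∑ k ∈ N, rho q1 qg cpm ccm cs k =
      ∑ k ∈ N, cpm k - (∑ k ∈ N, qg k * ccm k - ∑ k ∈ N, q1 k * ccm k) := by
  simp only [rho, ← sum_div, mul_div_cancel₀ _ hcs, sub_mul, sum_sub_distrib]

theorem prop3_cost_difference_all [DecidableEq α]
    (q1 qg cpm ccm : α → ℝ) (cs : ℝ) (N0 N1 : Finset α)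
    (hdisj : Disjoint N0 N1) (hN1 : N1.Nonempty)
    (hq1 : ∀ i ∈ N1, q1 i < 1) (hcs : cs ≠ 0) :
    cost q1 qg cpm ccm cs (N0 ∪ N1) (∅ : Finset α) - cost q1 qg cpm ccm cs N0 N1 =
      cs * (pProb q1 qg N0 N1 * sSet q1 qg N1 -
        (∑ k ∈ N1, rho q1 qg cpm ccm cs k) - 1) := by
  have hp := pProb_mul_sSet q1 qg N0 N1 fun i hi => (hq1 i hi).ne
  have hr := mul_sum_rho q1 qg cpm ccm N1 hcs
  rw [mul_sub, mul_sub, hp, hr]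
  simp only [cost, pProb, sum_union hdisj, prod_union hdisj, sum_empty, prod_empty,
    Finset.not_nonempty_empty, if_false, if_pos hN1]
  ring
end

section
/- Let N0, N1, Nu be pairwise disjoint finite sets of components with N0 ∪ N1 ∪ Nu = 𝒩, and let N be a nonempty subset of Nu. Assume 0 ≤ q1 i ≤ qg i < 1 for all i ∈ 𝒩, q1 i < qg i for all i ∈ N, cs > 0, and Σ_{k∈N} ρ_k ≥ 0. Then Δ_r(N0∪Nu, N1, N) ≥ Δ_s(N0, N1∪Nu, N), and equality holds when N = Nu. -/
open Finset

variable {α : Type*}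

theorem rSet_mul_pProb_union [DecidableEq α] (q1 qg : α → ℝ) {N0 N1 Nu N : Finset α}
    (h0u : Disjoint N0 Nu) (hN : N ⊆ Nu) (hqg : ∀ i ∈ N, qg i < 1) :
    rSet q1 qg N * pProb q1 qg (N0 ∪ Nu) N1 =
      ((∏ i ∈ N, (1 - q1 i)) - ∏ i ∈ N, (1 - qg i)) * pProb q1 qg N0 N1 *
        ∏ i ∈ Nu \ N, (1 - qg i) := by
  have hA : ∏ i ∈ N, (1 - qg i) ≠ 0 :=
    (prod_pos fun i hi => sub_pos.2 (hqg i hi)).ne'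
  rw [rSet, pProb, pProb, prod_union h0u, ← prod_sdiff hN, prod_div_distrib]
  field_simp

theorem sSet_mul_pProb_union [DecidableEq α] (q1 qg : α → ℝ) {N0 N1 Nu N : Finset α}
    (h1u : Disjoint N1 Nu) (hN : N ⊆ Nu) (hq1 : ∀ i ∈ N, q1 i < 1) :
    sSet q1 qg N * pProb q1 qg N0 (N1 ∪ Nu) =
      ((∏ i ∈ N, (1 - q1 i)) - ∏ i ∈ N, (1 - qg i)) * pProb q1 qg N0 N1 *
        ∏ i ∈ Nu \ N, (1 - q1 i) := by
  have hB : ∏ i ∈ N, (1 - q1 i) ≠ 0 :=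
    (prod_pos fun i hi => sub_pos.2 (hq1 i hi)).ne'
  rw [sSet, pProb, pProb, prod_union h1u, ← prod_sdiff hN, prod_div_distrib]
  field_simp

theorem corollary1 [DecidableEq α]
    (q1 qg cpm ccm : α → ℝ) (cs : ℝ) (N0 N1 Nu N : Finset α)
    (h01 : Disjoint N0 N1) (h0u : Disjoint N0 Nu) (h1u : Disjoint N1 Nu)
    (hN : N ⊆ Nu) (hNne : N.Nonempty)
    (hq : ∀ i ∈ N0 ∪ N1 ∪ Nu, 0 ≤ q1 i ∧ q1 i ≤ qg i ∧ qg i < 1)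
    (hstrict : ∀ i ∈ N, q1 i < qg i)
    (hcs : 0 < cs)
    (hrho : 0 ≤ ∑ k ∈ N, rho q1 qg cpm ccm cs k) :
    deltaR q1 qg cpm ccm cs (N0 ∪ Nu) N1 N ≥ deltaS q1 qg cpm ccm cs N0 (N1 ∪ Nu) N ∧
      (N = Nu →
        deltaR q1 qg cpm ccm cs (N0 ∪ Nu) N1 N =
          deltaS q1 qg cpm ccm cs N0 (N1 ∪ Nu) N) := by
  have hg : ∀ i ∈ N0 ∪ N1 ∪ Nu, 0 < 1 - qg i := fun i hi => sub_pos.2 (hq i hi).2.2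
  have h1 : ∀ i ∈ N0 ∪ N1 ∪ Nu, 0 < 1 - q1 i := fun i hi =>
    sub_pos.2 ((hq i hi).2.1.trans_lt (hq i hi).2.2)
  have hu : Nu ⊆ N0 ∪ N1 ∪ Nu := subset_union_right
  have hr := rSet_mul_pProb_union q1 qg (N1 := N1) h0u hN
    fun i hi => sub_pos.1 (hg i (hu (hN hi)))
  have hs := sSet_mul_pProb_union q1 qg (N0 := N0) h1u hN
    fun i hi => sub_pos.1 (h1 i (hu (hN hi)))
  have hp : 0 < pProb q1 qg N0 N1 :=
    mul_pos (prod_pos fun i hi => hg i (by simp [hi])) (prod_pos fun i hi => h1 i (by simp [hi]))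
  have hd : 0 < (∏ i ∈ N, (1 - q1 i)) - ∏ i ∈ N, (1 - qg i) :=
    sub_pos.2 <| prod_lt_prod_of_nonempty (fun i hi => hg i (hu (hN hi)))
      (fun i hi => sub_lt_sub_left (hstrict i hi) 1) hNne
  have hA : 0 < ∏ i ∈ Nu \ N, (1 - qg i) :=
    prod_pos fun i hi => hg i (hu (mem_sdiff.1 hi).1)
  have hAB : ∏ i ∈ Nu \ N, (1 - qg i) ≤ ∏ i ∈ Nu \ N, (1 - q1 i) :=
    prod_le_prod (fun i hi => (hg i (hu (mem_sdiff.1 hi).1)).le)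
      fun i hi => sub_le_sub_left (hq i (hu (mem_sdiff.1 hi).1)).2.1 1
  have hsd : (N1 ∪ Nu) \ N = N1 ∪ Nu \ N := by
    rw [union_sdiff_distrib, sdiff_eq_self_of_disjoint (h1u.mono_right hN)]
  have hden := mul_le_mul_of_nonneg_left hAB (mul_pos hd hp).le
  have hden_pos := mul_pos (mul_pos hd hp) hA
  rw [deltaR, deltaS, hr, hs, hsd]
  refine ⟨?_, ?_⟩
  · by_cases h : N1.Nonempty
    · rw [if_pos h, if_pos (h.mono subset_union_left)]
      exact div_le_div_of_nonneg_left hrho hden_pos hden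
    · rw [if_neg h]
      refine div_le_div_of_nonneg_left (by linarith) hden_pos hden |>.trans' ?_
      split_ifs
      · exact div_le_div_of_nonneg_right (by linarith) (hden_pos.le.trans hden)
      · exact le_rfl
  · rintro rfl
    simp
end

section
/- Let N0, N1, Nu be pairwise disjoint finite sets of components with N0 ∪ N1 ∪ Nu = 𝒩, and let N be a nonempty subset of Nu. Assume 0 ≤ q1 i ≤ qg i < 1 for all i ∈ 𝒩, q1 i < qg i for all i ∈ N, and cs > 0. Then it is impossible that both Δ_r(N0∪Nu, N1, N) < 1 and Δ_s(N0, N1∪Nu, N) > 1 hold; that is, a set N of undetermined components cannot simultaneously satisfy the improvement condition of Proposition 2 (for moving N into the maintenance set) and the improvement condition of Proposition 3 (for moving N into the do-nothing set). -/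
open Finset

variable {α : Type*}

/-- Cancelling the denominators of `r_N` against `p(N0, N1)` when `N ⊆ N0`. -/
theorem rSet_mul_pProb [DecidableEq α] {q1 qg : α → ℝ} {N0 N1 N : Finset α} (hN : N ⊆ N0)
    (h : ∀ i ∈ N, 1 - qg i ≠ 0) :
    rSet q1 qg N * pProb q1 qg N0 N1 =
      (∏ i ∈ N, (1 - q1 i) - ∏ i ∈ N, (1 - qg i)) * pProb q1 qg (N0 \ N) N1 := by
  have hA : ∏ i ∈ N, (1 - qg i) ≠ 0 := prod_ne_zero_iff.mpr h
  simp only [rSet, pProb, prod_div_distrib, ← prod_sdiff hN]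
  field_simp

/-- Cancelling the denominators of `s_N` against `p(N0, N1)` when `N ⊆ N1`. -/
theorem sSet_mul_pProb [DecidableEq α] {q1 qg : α → ℝ} {N0 N1 N : Finset α} (hN : N ⊆ N1)
    (h : ∀ i ∈ N, 1 - q1 i ≠ 0) :
    sSet q1 qg N * pProb q1 qg N0 N1 =
      (∏ i ∈ N, (1 - q1 i) - ∏ i ∈ N, (1 - qg i)) * pProb q1 qg N0 (N1 \ N) := by
  have hB : ∏ i ∈ N, (1 - q1 i) ≠ 0 := prod_ne_zero_iff.mpr h
  simp only [sSet, pProb, prod_div_distrib, ← prod_sdiff hN]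
  field_simp

/-- Maintaining the components of `M` does not decrease the probability of no failure. -/
theorem pProb_union_left_le_union_right [DecidableEq α] {q1 qg : α → ℝ} {N0 N1 M : Finset α}
    (h0 : Disjoint N0 M) (h1 : Disjoint N1 M) (hq0 : ∀ i ∈ N0, qg i ≤ 1)
    (hq1 : ∀ i ∈ N1, q1 i ≤ 1) (hM : ∀ i ∈ M, q1 i ≤ qg i ∧ qg i ≤ 1) :
    pProb q1 qg (N0 ∪ M) N1 ≤ pProb q1 qg N0 (N1 ∪ M) := by
  have hP0 : 0 ≤ ∏ i ∈ N0, (1 - qg i) := prod_nonneg fun i hi => sub_nonneg.mpr (hq0 i hi)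
  have hP1 : 0 ≤ ∏ i ∈ N1, (1 - q1 i) := prod_nonneg fun i hi => sub_nonneg.mpr (hq1 i hi)
  have hab : ∏ i ∈ M, (1 - qg i) ≤ ∏ i ∈ M, (1 - q1 i) :=
    prod_le_prod (fun i hi => sub_nonneg.mpr (hM i hi).2)
      fun i hi => sub_le_sub_left (hM i hi).1 1
  simp only [pProb, prod_union h0, prod_union h1]
  linarith [mul_le_mul_of_nonneg_left hab (mul_nonneg hP0 hP1)]

theorem no_simultaneous_improvement [DecidableEq α]
    (q1 qg cpm ccm : α → ℝ) (cs : ℝ) (N0 N1 Nu N : Finset α)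
    (h01 : Disjoint N0 N1) (h0u : Disjoint N0 Nu) (h1u : Disjoint N1 Nu)
    (hN : N ⊆ Nu) (hNne : N.Nonempty)
    (hq : ∀ i ∈ N0 ∪ N1 ∪ Nu, 0 ≤ q1 i ∧ q1 i ≤ qg i ∧ qg i < 1)
    (hstrict : ∀ i ∈ N, q1 i < qg i)
    (hcs : 0 < cs) :
    ¬ (deltaR q1 qg cpm ccm cs (N0 ∪ Nu) N1 N < 1 ∧
        deltaS q1 qg cpm ccm cs N0 (N1 ∪ Nu) N > 1) := by
  rintro ⟨hr, hs⟩
  have hqg : ∀ i ∈ N0 ∪ N1 ∪ Nu, qg i < 1 := fun i hi => (hq i hi).2.2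
  have hq1 : ∀ i ∈ N0 ∪ N1 ∪ Nu, q1 i < 1 := fun i hi => (hq i hi).2.1.trans_lt (hqg i hi)
  have hmem0 : ∀ i ∈ N0, i ∈ N0 ∪ N1 ∪ Nu := by grind
  have hmem1 : ∀ i ∈ N1, i ∈ N0 ∪ N1 ∪ Nu := by grind
  have hmemu : ∀ i ∈ Nu, i ∈ N0 ∪ N1 ∪ Nu := by grind
  have hgap : 0 < ∏ i ∈ N, (1 - q1 i) - ∏ i ∈ N, (1 - qg i) :=
    sub_pos.mpr <| prod_lt_prod_of_nonempty
      (fun i hi => sub_pos.mpr (hqg i (hmemu i (hN hi))))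
      (fun i hi => sub_lt_sub_left (hstrict i hi) 1) hNne
  have h0 : (N0 ∪ Nu) \ N = N0 ∪ Nu \ N := by
    rw [union_sdiff_distrib, sdiff_eq_self_of_disjoint (h0u.mono_right hN)]
  have h1 : (N1 ∪ Nu) \ N = N1 ∪ Nu \ N := by
    rw [union_sdiff_distrib, sdiff_eq_self_of_disjoint (h1u.mono_right hN)]
  have hDr := rSet_mul_pProb (q1 := q1) (N1 := N1) (hN.trans subset_union_right : N ⊆ N0 ∪ Nu)
    fun i hi => (sub_pos.mpr (hqg i (hmemu i (hN hi)))).ne'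
  have hDs := sSet_mul_pProb (qg := qg) (N0 := N0) (hN.trans subset_union_right : N ⊆ N1 ∪ Nu)
    fun i hi => (sub_pos.mpr (hq1 i (hmemu i (hN hi)))).ne'
  rw [h0] at hDr
  rw [h1] at hDs
  have hp : 0 < pProb q1 qg (N0 ∪ Nu \ N) N1 :=
    pProb_pos (fun i hi => hqg i (by grind)) fun i hi => hq1 i (hmem1 i hi)
  have hple : pProb q1 qg (N0 ∪ Nu \ N) N1 ≤ pProb q1 qg N0 (N1 ∪ Nu \ N) :=
    pProb_union_left_le_union_right (h0u.mono_right sdiff_subset) (h1u.mono_right sdiff_subset)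
      (fun i hi => (hqg i (hmem0 i hi)).le) (fun i hi => (hq1 i (hmem1 i hi)).le)
      fun i hi => (hq i (hmemu i (sdiff_subset hi))).2.imp_right le_of_lt
  have hle := mul_le_mul_of_nonneg_left hple hgap.le
  have hr_pos := mul_pos hgap hp
  have hs_pos := hr_pos.trans_le hle
  have hne : N1.Nonempty → (N1 ∪ Nu \ N).Nonempty := fun h => h.mono subset_union_left
  rw [deltaR, hDr] at hr
  rw [deltaS, hDs, h1] at hs
  split_ifs at hr hs with hN1 hN1u
  all_goals
    first
    | exact absurd (hne ‹_›) ‹_›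
    | rw [div_lt_one hr_pos] at hr
      rw [gt_iff_lt, one_lt_div hs_pos] at hs
      linarith
end

section
/- Let N0, N1, Nu be pairwise disjoint finite sets of components and let N ⊆ Nu. Assume 0 ≤ q1 i ≤ qg i < 1 for all i ∈ N0 ∪ N1 ∪ Nu. Then p(N0∪Nu, N1)·r_N ≤ p(N0, N1∪Nu)·s_N, and equality holds when N = Nu. -/
open Finset

variable {α : Type*}

theorem prod_mul_rSet [DecidableEq α] {q1 qg : α → ℝ} {N M : Finset α} (hN : N ⊆ M)
    (hg : ∀ i ∈ N, 1 - qg i ≠ 0) :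
    (∏ i ∈ M, (1 - qg i)) * rSet q1 qg N =
      (∏ i ∈ M \ N, (1 - qg i)) * (∏ i ∈ N, (1 - q1 i) - ∏ i ∈ N, (1 - qg i)) := by
  have h := prod_ne_zero_iff.mpr hg
  rw [rSet, ← prod_sdiff hN, prod_div_distrib]
  field_simp

theorem prod_mul_sSet [DecidableEq α] {q1 qg : α → ℝ} {N M : Finset α} (hN : N ⊆ M)
    (h1 : ∀ i ∈ N, 1 - q1 i ≠ 0) :
    (∏ i ∈ M, (1 - q1 i)) * sSet q1 qg N =
      (∏ i ∈ M \ N, (1 - q1 i)) * (∏ i ∈ N, (1 - q1 i) - ∏ i ∈ N, (1 - qg i)) := by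
  have h := prod_ne_zero_iff.mpr h1
  rw [sSet, ← prod_sdiff hN, prod_div_distrib]
  field_simp

theorem p_r_le_p_s [DecidableEq α]
    (q1 qg : α → ℝ) (N0 N1 Nu N : Finset α)
    (h01 : Disjoint N0 N1) (h0u : Disjoint N0 Nu) (h1u : Disjoint N1 Nu)
    (hN : N ⊆ Nu)
    (hq : ∀ i ∈ N0 ∪ N1 ∪ Nu, 0 ≤ q1 i ∧ q1 i ≤ qg i ∧ qg i < 1) :
    pProb q1 qg (N0 ∪ Nu) N1 * rSet q1 qg N ≤
      pProb q1 qg N0 (N1 ∪ Nu) * sSet q1 qg N ∧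
      (N = Nu →
        pProb q1 qg (N0 ∪ Nu) N1 * rSet q1 qg N =
          pProb q1 qg N0 (N1 ∪ Nu) * sSet q1 qg N) := by
  have hlt : ∀ i ∈ N0 ∪ N1 ∪ Nu, 0 < 1 - qg i ∧ 1 - qg i ≤ 1 - q1 i := fun i hi => by
    have := hq i hi
    constructor <;> linarith
  have hu : ∀ i ∈ Nu, 0 < 1 - qg i ∧ 1 - qg i ≤ 1 - q1 i := fun i hi =>
    hlt i (mem_union_right _ hi)
  have hr : pProb q1 qg (N0 ∪ Nu) N1 * rSet q1 qg N = pProb q1 qg N0 N1 *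
      ((∏ i ∈ Nu \ N, (1 - qg i)) * (∏ i ∈ N, (1 - q1 i) - ∏ i ∈ N, (1 - qg i))) := by
    rw [← prod_mul_rSet hN fun i hi => (hu i (hN hi)).1.ne', pProb, pProb, prod_union h0u]
    ring
  have hs : pProb q1 qg N0 (N1 ∪ Nu) * sSet q1 qg N = pProb q1 qg N0 N1 *
      ((∏ i ∈ Nu \ N, (1 - q1 i)) * (∏ i ∈ N, (1 - q1 i) - ∏ i ∈ N, (1 - qg i))) := by
    rw [← prod_mul_sSet hN fun i hi => ((hu i (hN hi)).1.trans_le (hu i (hN hi)).2).ne',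
      pProb, pProb, prod_union h1u]
    ring
  rw [hr, hs]
  refine ⟨?_, fun h => by simp [h]⟩
  have hp : 0 ≤ pProb q1 qg N0 N1 :=
    mul_nonneg (prod_nonneg fun i hi => (hlt i (by simp [hi])).1.le)
      (prod_nonneg fun i hi => (hlt i (by simp [hi])).1.le.trans (hlt i (by simp [hi])).2)
  have hd : 0 ≤ ∏ i ∈ N, (1 - q1 i) - ∏ i ∈ N, (1 - qg i) :=
    sub_nonneg.mpr (prod_le_prod (fun i hi => (hu i (hN hi)).1.le) fun i hi => (hu i (hN hi)).2)
  have hm : ∏ i ∈ Nu \ N, (1 - qg i) ≤ ∏ i ∈ Nu \ N, (1 - q1 i) :=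
    prod_le_prod (fun i hi => (hu i (sdiff_subset hi)).1.le) fun i hi => (hu i (sdiff_subset hi)).2
  gcongr
end

section
/- Let ι be a finite index set and let u, v : ι → ℝ satisfy 0 ≤ u i ≤ v i ≤ 1 for every i ∈ ι. Then Σ_{i∈ι} u i + Π_{i∈ι} (1 − u i) ≤ Σ_{i∈ι} v i + Π_{i∈ι} (1 − v i); that is, the function f(v_1,…,v_n) = Σ_i v_i + Π_i (1 − v_i) is componentwise nondecreasing on [0,1]^n. -/
theorem Finset.sum_add_prod_one_sub_le {ι : Type*} (s : Finset ι) {u v : ι → ℝ}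
    (h : ∀ i ∈ s, 0 ≤ u i ∧ u i ≤ v i ∧ v i ≤ 1) :
    (∑ i ∈ s, u i) + ∏ i ∈ s, (1 - u i) ≤ (∑ i ∈ s, v i) + ∏ i ∈ s, (1 - v i) := by
  induction s using Finset.cons_induction with
  | empty => simp
  | cons a s ha ih =>
    have hs : ∀ i ∈ s, 0 ≤ u i ∧ u i ≤ v i ∧ v i ≤ 1 :=
      fun i hi => h i (Finset.mem_cons_of_mem hi)
    obtain ⟨hu, huv, -⟩ := h a (Finset.mem_cons_self a s)
    have hle : ∏ i ∈ s, (1 - v i) ≤ ∏ i ∈ s, (1 - u i) :=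
      Finset.prod_le_prod (fun i hi => by linarith [hs i hi]) (fun i hi => by linarith [hs i hi])
    have hone : ∏ i ∈ s, (1 - v i) ≤ 1 :=
      Finset.prod_le_one (fun i hi => by linarith [hs i hi]) (fun i hi => by linarith [hs i hi])
    rw [Finset.sum_cons, Finset.sum_cons, Finset.prod_cons, Finset.prod_cons]
    linarith [ih hs, mul_nonneg hu (sub_nonneg.2 hle),
      mul_nonneg (sub_nonneg.2 huv) (sub_nonneg.2 hone)]

theorem sum_add_prod_monotone {ι : Type*} [Fintype ι] (u v : ι → ℝ)
    (h : ∀ i : ι, 0 ≤ u i ∧ u i ≤ v i ∧ v i ≤ 1) :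
    (∑ i : ι, u i) + (∏ i : ι, (1 - u i)) ≤
      (∑ i : ι, v i) + (∏ i : ι, (1 - v i)) :=
  Finset.univ.sum_add_prod_one_sub_le fun i _ => h i
end

section
/- Let (N0,N1) be a partition of 𝒩 and let k ∈ N0 be a component that is as good as new, i.e., q1 k = qg k. Assume 0 ≤ q1 i and 0 ≤ qg i ≤ 1 for all i, cpm k > 0, and cs ≥ 0. Then C(N0\{k}, N1∪{k}) > C(N0,N1); that is, it is never beneficial to maintain a new component. -/
open Finset

variable {α : Type*}

theorem never_maintain_new_component [DecidableEq α]
    (q1 qg cpm ccm : α → ℝ) (cs : ℝ) (N0 N1 : Finset α) (k : α)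
    (hdisj : Disjoint N0 N1) (hk : k ∈ N0)
    (hnew : q1 k = qg k)
    (hq : ∀ i ∈ N0 ∪ N1, 0 ≤ q1 i ∧ 0 ≤ qg i ∧ qg i ≤ 1)
    (hcpm : 0 < cpm k) (hcs : 0 ≤ cs) :
    cost q1 qg cpm ccm cs N0 N1 <
      cost q1 qg cpm ccm cs (N0 \ {k}) (N1 ∪ {k}) := by
  have hk1 : k ∉ N1 := Finset.disjoint_left.mp hdisj hk
  have hunion : N1 ∪ {k} = insert k N1 := by rw [Finset.union_comm]; rfl
  have hne : (insert k N1).Nonempty := Finset.insert_nonempty k N1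
  have hsetup : (if N1.Nonempty then cs else 0) ≤ cs := by split_ifs <;> linarith
  have hsum := Finset.add_sum_erase N0 (fun i => qg i * ccm i) hk
  have hprod := Finset.mul_prod_erase N0 (fun i => 1 - qg i) hk
  simp only [cost, hunion, Finset.sdiff_singleton_eq_erase, Finset.sum_insert hk1,
    Finset.prod_insert hk1, if_pos hne, hnew]
  rw [← hsum, ← hprod]
  linarith
end
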